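/- Let R = k⟨x₁,…,xₙ⟩/(xᵢxⱼ + xⱼxᵢ − 1 for all i ≠ j) be the quantum Weyl algebra with n ≥ 2, filtered by F_i R = (k + Σ k xₛ)^i. Then the associated graded algebra gr R is isomorphic to the skew polynomial ring k_{−1}[x₁,…,xₙ] with relations xⱼxᵢ = −xᵢxⱼ for i < j. -/

import Mathlib

noncomputable section

variable (k : Type*) [Field k] (n : ℕ)

/-- The defining relations `xᵢxⱼ + xⱼxᵢ = 1` (`i ≠ j`) of the quantum Weyl algebra. -/
inductive WeylRel : FreeAlgebra k (Fin n) → FreeAlgebra k (Fin n) → Prop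
  | rel (i j : Fin n) (h : i ≠ j) :
      WeylRel (FreeAlgebra.ι k i * FreeAlgebra.ι k j + FreeAlgebra.ι k j * FreeAlgebra.ι k i) 1

/-- The quantum Weyl algebra `R`. -/
def Weyl : Type _ := RingQuot (WeylRel k n)

instance : Ring (Weyl k n) := inferInstanceAs (Ring (RingQuot _))
instance : Algebra k (Weyl k n) := inferInstanceAs (Algebra k (RingQuot _))

/-- The generators of the quantum Weyl algebra. -/
def wgen (s : Fin n) : Weyl k n := RingQuot.mkAlgHom k (WeylRel k n) (FreeAlgebra.ι k s)

/-- The subspace `k + Σ k xₛ` generating the standard filtration. -/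
def weylV : Submodule k (Weyl k n) := Submodule.span k ({1} ∪ Set.range (wgen k n))

/-- The filtration `F i R = (k + Σ k xₛ)^i` shifted down by one: `F (-1) = 0`. -/
def prevF : ℕ → Submodule k (Weyl k n)
  | 0 => ⊥
  | (i + 1) => weylV k n ^ i

/-- The `i`-th graded piece `F i R / F (i-1) R` of the associated graded algebra. -/
def GrW (i : ℕ) : Type _ :=
  ↥(weylV k n ^ i) ⧸ ((prevF k n i).comap (weylV k n ^ i).subtype)

instance (i : ℕ) : AddCommGroup (GrW k n i) := by
  unfold GrW; infer_instance

instance (i : ℕ) : Module k (GrW k n i) := by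
  unfold GrW; infer_instance

/-- The canonical map `F i R → F i R / F (i-1) R`. -/
def grWMk (i : ℕ) (u : ↥(weylV k n ^ i)) : GrW k n i :=
  Submodule.Quotient.mk u

/-- The defining relations `xⱼxᵢ = -xᵢxⱼ` (`i < j`) of `k₋₁[x₁,…,xₙ]`. -/
inductive SkewRel : FreeAlgebra k (Fin n) → FreeAlgebra k (Fin n) → Prop
  | rel (i j : Fin n) (h : i < j) :
      SkewRel (FreeAlgebra.ι k j * FreeAlgebra.ι k i) (-(FreeAlgebra.ι k i * FreeAlgebra.ι k j))

/-- The skew polynomial ring `k₋₁[x₁,…,xₙ]`. -/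
def SkewPolyRing : Type _ := RingQuot (SkewRel k n)

instance : Ring (SkewPolyRing k n) := inferInstanceAs (Ring (RingQuot _))
instance : Algebra k (SkewPolyRing k n) := inferInstanceAs (Algebra k (RingQuot _))

/-- The generators of `k₋₁[x₁,…,xₙ]`. -/
def sgen (s : Fin n) : SkewPolyRing k n :=
  RingQuot.mkAlgHom k (SkewRel k n) (FreeAlgebra.ι k s)

/-- The degree-`i` homogeneous component of `k₋₁[x₁,…,xₙ]`: the span of products of `i`
generators. -/
def skewDeg (i : ℕ) : Submodule k (SkewPolyRing k n) :=
  Submodule.span k {m | ∃ w : List (Fin n), w.length = i ∧ m = (w.map (sgen k n)).prod}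

theorem one_mem_weylV_pow_zero : (1 : Weyl k n) ∈ weylV k n ^ 0 := by
  rw [pow_zero]
  exact Submodule.one_le.1 le_rfl

theorem wgen_mem_weylV_pow_one (s : Fin n) : wgen k n s ∈ weylV k n ^ 1 := by
  rw [pow_one]
  exact Submodule.subset_span (Set.mem_union_right _ (Set.mem_range_self s))

theorem mul_mem_weylV_pow {i j : ℕ} (u : ↥(weylV k n ^ i)) (v : ↥(weylV k n ^ j)) :
    (u : Weyl k n) * (v : Weyl k n) ∈ weylV k n ^ (i + j) := by
  rw [pow_add]
  exact Submodule.mul_mem_mul u.2 v.2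

universe u

/-- The span of the products of fewer than `m` members of the family `g`. -/
def wordsLT {k A : Type*} [Field k] [Ring A] [Algebra k A] {n : ℕ} (g : Fin n → A) (m : ℕ) :
    Submodule k A :=
  Submodule.span k {a | ∃ w : List (Fin n), w.length < m ∧ (w.map g).prod = a}

section Words

variable {k A : Type*} [Field k] [Ring A] [Algebra k A] {n : ℕ} {g : Fin n → A}

theorem prod_mem_wordsLT {w : List (Fin n)} {m : ℕ} (h : w.length < m) :
    (w.map g).prod ∈ wordsLT (k := k) g m :=
  Submodule.subset_span ⟨w, h, rfl⟩

theorem wordsLT_mono {l m : ℕ} (h : l ≤ m) : wordsLT (k := k) g l ≤ wordsLT g m :=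
  Submodule.span_mono fun _ ⟨w, hw, e⟩ => ⟨w, hw.trans_le h, e⟩

theorem wordsLT_le {m : ℕ} {N : Submodule k A}
    (h : ∀ w : List (Fin n), w.length < m → (w.map g).prod ∈ N) : wordsLT g m ≤ N :=
  Submodule.span_le.2 fun _ ⟨w, hw, e⟩ => e ▸ h w hw

theorem mul_mem_wordsLT (i : Fin n) {m : ℕ} {y : A} (hy : y ∈ wordsLT (k := k) g m) :
    g i * y ∈ wordsLT (k := k) g (m + 1) := by
  have : wordsLT g m ≤ (wordsLT (k := k) g (m + 1)).comap (LinearMap.mulLeft k (g i)) :=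
    wordsLT_le fun w hw => by
      simpa using prod_mem_wordsLT (k := k) (g := g) (w := i :: w) (m := m + 1) (by simpa using hw)
  exact this hy

theorem span_pow_eq_wordsLT (i : ℕ) :
    Submodule.span k ({1} ∪ Set.range g) ^ i = wordsLT g (i + 1) := by
  apply le_antisymm
  · induction i with
    | zero =>
      rw [pow_zero, Submodule.one_le]
      exact prod_mem_wordsLT (w := []) (by simp)
    | succ i ih =>
      rw [pow_succ', Submodule.mul_le]
      intro a ha b hb
      have hb := ih hb
      induction ha using Submodule.span_induction with
      | mem x hx =>
        rcases hx with rfl | ⟨s, rfl⟩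
        · rw [one_mul]
          exact wordsLT_mono (by omega) hb
        · exact mul_mem_wordsLT s hb
      | zero => simp
      | add x y _ _ hx hy => rw [add_mul]; exact add_mem hx hy
      | smul c x _ hx => rw [smul_mul_assoc]; exact Submodule.smul_mem _ _ hx
  · refine wordsLT_le fun w hw => ?_
    induction w generalizing i with
    | nil =>
      have h1 : 1 ≤ Submodule.span k ({1} ∪ Set.range g) :=
        Submodule.one_le.2 (Submodule.subset_span (by simp))
      simpa using Submodule.one_le.1 (one_le_pow_of_one_le' h1 i)
    | cons s w ih =>
      obtain _ | i := i
      · simp at hw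
      · rw [pow_succ', List.map_cons, List.prod_cons]
        exact Submodule.mul_mem_mul (Submodule.subset_span (by simp))
          (ih i (by simpa using hw))

end Words

/-- The family `g` presents `A` as the algebra with relations `gᵢgⱼ + gⱼgᵢ = q` (`i ≠ j`). -/
structure IsAnticommPresentation {k : Type u} {A : Type u} [Field k] [Ring A] [Algebra k A]
    {n : ℕ} (q : k) (g : Fin n → A) : Prop where
  rel : ∀ i j, i ≠ j → g i * g j + g j * g i = algebraMap k A q
  exists_lift : ∀ (B : Type u) [Ring B] [Algebra k B] (f : Fin n → B),
    (∀ i j, i ≠ j → f i * f j + f j * f i = algebraMap k B q) →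
      ∃ φ : A →ₐ[k] B, ∀ i, φ (g i) = f i
  adjoin_eq_top : Algebra.adjoin k (Set.range g) = ⊤

namespace IsAnticommPresentation

variable {k A B : Type u} [Field k] [Ring A] [Algebra k A] [Ring B] [Algebra k B]
  {n : ℕ} {q q' : k} {g : Fin n → A} {g' : Fin n → B}

theorem mem_of_mul_closed (hA : IsAnticommPresentation q g) {N : Submodule k A}
    (h1 : 1 ∈ N) (hg : ∀ i y, y ∈ N → g i * y ∈ N) (a : A) : a ∈ N := by
  have ha : a ∈ Algebra.adjoin k (Set.range g) := hA.adjoin_eq_top ▸ Algebra.mem_top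
  suffices ∀ y ∈ N, a * y ∈ N by simpa using this 1 h1
  induction ha using Algebra.adjoin_induction with
  | mem x hx =>
    obtain ⟨i, rfl⟩ := hx
    exact hg i
  | algebraMap r =>
    intro y hy
    rw [← Algebra.smul_def]
    exact N.smul_mem r hy
  | add x y _ _ hx hy =>
    intro z hz
    rw [add_mul]
    exact N.add_mem (hx z hz) (hy z hz)
  | mul x y _ _ hx hy =>
    intro z hz
    rw [mul_assoc]
    exact hx _ (hy z hz)

theorem exists_skewDerivation (hA : IsAnticommPresentation q g) (c : Fin n → k) :
    ∃ D : A →ₗ[k] A, D 1 = 0 ∧ ∀ j y, D (g j * y) = c j • y - g j * D y := by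
  obtain ⟨Φ, hΦ⟩ := hA.exists_lift (Matrix (Fin 2) (Fin 2) A)
    (fun j => !![-g j, algebraMap k A (c j); 0, g j]) (by
      intro i j hij
      have h := hA.rel i j hij
      ext a b
      fin_cases a <;> fin_cases b <;>
        simp [Matrix.algebraMap_matrix_apply, h]
      rw [Algebra.smul_def, Algebra.smul_def, Algebra.commutes (c i), Algebra.commutes (c j)]
      abel)
  have h11 (y : A) : Φ y 1 1 = y := by
    refine hA.mem_of_mul_closed (N := LinearMap.eqLocus
      (Matrix.entryLinearMap k A 1 1 ∘ₗ Φ.toLinearMap) LinearMap.id) ?_ ?_ y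
    · simp [LinearMap.mem_eqLocus]
    · intro i y hy
      simp only [LinearMap.mem_eqLocus, LinearMap.comp_apply, AlgHom.toLinearMap_apply,
        Matrix.entryLinearMap_apply, LinearMap.id_apply] at hy ⊢
      simp [hΦ, Matrix.mul_apply, Fin.sum_univ_two, hy]
  refine ⟨Matrix.entryLinearMap k A 0 1 ∘ₗ Φ.toLinearMap, by simp, fun j y => ?_⟩
  simp only [LinearMap.comp_apply, AlgHom.toLinearMap_apply, Matrix.entryLinearMap_apply, map_mul,
    hΦ, Matrix.mul_apply, Fin.sum_univ_two, h11]
  simp [Algebra.smul_def, neg_add_eq_sub]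

theorem skewDerivation_anticomm (hA : IsAnticommPresentation q g) {D D' : A →ₗ[k] A}
    {c c' : Fin n → k} (h1 : D 1 = 0) (h1' : D' 1 = 0)
    (hD : ∀ j y, D (g j * y) = c j • y - g j * D y)
    (hD' : ∀ j y, D' (g j * y) = c' j • y - g j * D' y) (y : A) :
    D (D' y) + D' (D y) = 0 := by
  refine hA.mem_of_mul_closed (N := LinearMap.ker (D ∘ₗ D' + D' ∘ₗ D)) ?_ ?_ y
  · simp [h1, h1']
  · intro i y hy
    simp only [LinearMap.mem_ker, LinearMap.add_apply, LinearMap.comp_apply] at hy ⊢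
    simp only [hD, hD', map_sub, map_smul]
    have : g i * (D (D' y) + D' (D y)) = 0 := by rw [hy, mul_zero]
    rw [mul_add] at this
    rw [← this]
    abel

theorem skewDerivation_mem_wordsLT {D : A →ₗ[k] A} {c : Fin n → k} (h1 : D 1 = 0)
    (hD : ∀ j y, D (g j * y) = c j • y - g j * D y) {m : ℕ} {y : A}
    (hy : y ∈ wordsLT (k := k) g m) : D y ∈ wordsLT (k := k) g m := by
  have hw (w : List (Fin n)) :
      D (w.map g).prod ∈ wordsLT (k := k) g (w.length + 1) := by
    induction w with
    | nil => simp [h1]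
    | cons i w ih =>
      rw [List.map_cons, List.prod_cons, hD]
      exact sub_mem (Submodule.smul_mem _ _ (prod_mem_wordsLT (by simp)))
        (mul_mem_wordsLT i ih)
  exact wordsLT_le (N := (wordsLT g m).comap D) (fun w h => wordsLT_mono h (hw w)) hy

/-- Between algebras with anticommutation constants `q` and `q'` there is a linear map which is
the identity on words up to shorter words. -/
theorem exists_linearMap (hA : IsAnticommPresentation q g) (hB : IsAnticommPresentation q' g') :
    ∃ ψ : A →ₗ[k] B, ∀ w : List (Fin n),
      ψ (w.map g).prod - (w.map g').prod ∈ wordsLT (k := k) g' w.length := by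
  choose D hD1 hD using fun i : Fin n =>
    hB.exists_skewDerivation fun j => if i < j then q - q' else 0
  obtain ⟨ρ, hρ⟩ := hA.exists_lift (Module.End k B)
    (fun i => LinearMap.mulLeft k (g' i) + D i) (by
      intro i j hij
      ext y
      have hr : g' i * (g' j * y) + g' j * (g' i * y) = q' • y := by
        rw [← mul_assoc, ← mul_assoc, ← add_mul, hB.rel i j hij, Algebra.smul_def]
      have ha := hB.skewDerivation_anticomm (hD1 i) (hD1 j) (hD i) (hD j) y
      have hc : (if i < j then q - q' else 0) • y + (if j < i then q - q' else 0) • y =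
          q • y - q' • y := by
        rcases lt_or_gt_of_ne hij with h | h <;> simp [h, h.not_gt, sub_smul]
      simp only [LinearMap.add_apply, Module.End.mul_apply, LinearMap.mulLeft_apply, hD,
        mul_add, Module.algebraMap_end_apply]
      linear_combination (norm := module) hr + ha + hc)
  refine ⟨LinearMap.applyₗ 1 ∘ₗ ρ.toLinearMap, fun w => ?_⟩
  induction w with
  | nil => simp
  | cons i w ih =>
    simp only [LinearMap.comp_apply, AlgHom.toLinearMap_apply, LinearMap.applyₗ_apply_apply,
      List.map_cons, List.prod_cons, map_mul, hρ, Module.End.mul_apply, LinearMap.add_apply,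
      LinearMap.mulLeft_apply, List.length_cons] at ih ⊢
    have hm : ρ (w.map g).prod 1 ∈ wordsLT (k := k) g' (w.length + 1) := by
      rw [← sub_add_cancel (ρ (w.map g).prod 1) (w.map g').prod]
      exact add_mem (wordsLT_mono (by omega) ih) (prod_mem_wordsLT (by omega))
    rw [add_sub_right_comm, ← mul_sub]
    exact add_mem (mul_mem_wordsLT i ih) (skewDerivation_mem_wordsLT (hD1 i) (hD i) hm)

/-- The projection onto words of length `i`, when the relations are homogeneous. -/
theorem exists_proj (hA : IsAnticommPresentation (0 : k) g) (i : ℕ) :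
    ∃ π : A →ₗ[k] A, ∀ w : List (Fin n),
      π (w.map g).prod = if w.length = i then (w.map g).prod else 0 := by
  obtain ⟨δ, hδ⟩ := hA.exists_lift (Polynomial A) (fun j => Polynomial.monomial 1 (g j)) (by
    intro a b hab
    rw [Polynomial.monomial_mul_monomial, Polynomial.monomial_mul_monomial, ← map_add,
      hA.rel a b hab]
    simp)
  have hw (w : List (Fin n)) : δ (w.map g).prod = Polynomial.monomial w.length (w.map g).prod := by
    induction w with
    | nil => simp
    | cons a w ih =>
      rw [List.map_cons, List.prod_cons, map_mul, ih, hδ, Polynomial.monomial_mul_monomial,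
        List.length_cons, add_comm]
  refine ⟨(Polynomial.lcoeff A i).restrictScalars k ∘ₗ δ.toLinearMap, fun w => ?_⟩
  simp [hw, Polynomial.coeff_monomial]

end IsAnticommPresentation

theorem ringQuot_adjoin_eq_top {k X : Type*} [Field k]
    (r : FreeAlgebra k X → FreeAlgebra k X → Prop) :
    Algebra.adjoin k (Set.range fun x => RingQuot.mkAlgHom k r (FreeAlgebra.ι k x)) = ⊤ := by
  have h : (Set.range fun x => RingQuot.mkAlgHom k r (FreeAlgebra.ι k x)) =
      RingQuot.mkAlgHom k r '' Set.range (FreeAlgebra.ι k) := by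
    rw [← Set.range_comp]
    rfl
  rw [h, ← AlgHom.map_adjoin, FreeAlgebra.adjoin_range_ι, Algebra.map_top, AlgHom.range_eq_top]
  exact RingQuot.mkAlgHom_surjective k r

theorem isAnticommPresentation_wgen :
    IsAnticommPresentation (1 : k) (wgen k n) where
  rel i j h := by
    rw [map_one]
    have := RingQuot.mkAlgHom_rel k (WeylRel.rel (k := k) i j h)
    rw [map_add, map_mul, map_mul, map_one] at this
    exact this
  exists_lift B _ _ f hf :=
    ⟨RingQuot.liftAlgHom k ⟨FreeAlgebra.lift k f, fun _ _ h => by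
      cases h with
      | rel i j h => simpa using hf i j h⟩, fun i =>
        (RingQuot.liftAlgHom_mkAlgHom_apply ..).trans (FreeAlgebra.lift_ι_apply f i)⟩
  adjoin_eq_top := ringQuot_adjoin_eq_top (WeylRel k n)

theorem isAnticommPresentation_sgen :
    IsAnticommPresentation (0 : k) (sgen k n) where
  rel i j h := by
    have key (i j : Fin n) (h : i < j) : sgen k n j * sgen k n i = -(sgen k n i * sgen k n j) := by
      have := RingQuot.mkAlgHom_rel k (SkewRel.rel (k := k) i j h)
      rw [map_neg, map_mul, map_mul] at this
      exact this
    rw [map_zero]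
    rcases lt_or_gt_of_ne h with h | h
    · rw [key i j h, add_neg_cancel]
    · rw [key j i h, neg_add_cancel]
  exists_lift B _ _ f hf :=
    ⟨RingQuot.liftAlgHom k ⟨FreeAlgebra.lift k f, fun _ _ h => by
      cases h with
      | rel i j h =>
        have := hf j i h.ne'
        rw [map_zero] at this
        simpa using eq_neg_of_add_eq_zero_left this⟩, fun i =>
        (RingQuot.liftAlgHom_mkAlgHom_apply ..).trans (FreeAlgebra.lift_ι_apply f i)⟩
  adjoin_eq_top := ringQuot_adjoin_eq_top (SkewRel k n)

theorem weylV_pow_eq_wordsLT (i : ℕ) :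
    weylV k n ^ i = wordsLT (wgen k n) (i + 1) :=
  span_pow_eq_wordsLT i

theorem prevF_eq_wordsLT (i : ℕ) :
    prevF k n i = wordsLT (wgen k n) i := by
  cases i with
  | zero => simp [prevF, wordsLT]
  | succ i => exact weylV_pow_eq_wordsLT k n i

/-- The linear maps taking an element of degree at most `i` to its leading term. -/
theorem exists_symbol (i : ℕ) :
    ∃ σ : Weyl k n →ₗ[k] SkewPolyRing k n, ∀ w : List (Fin n), w.length ≤ i →
      σ (w.map (wgen k n)).prod = if w.length = i then (w.map (sgen k n)).prod else 0 := by
  obtain ⟨ψ, hψ⟩ :=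
    (isAnticommPresentation_wgen k n).exists_linearMap (isAnticommPresentation_sgen k n)
  obtain ⟨π, hπ⟩ := (isAnticommPresentation_sgen k n).exists_proj i
  refine ⟨π ∘ₗ ψ, fun w hw => ?_⟩
  have h0 : wordsLT (sgen k n) i ≤ LinearMap.ker π :=
    wordsLT_le fun v hv => by rw [LinearMap.mem_ker, hπ, if_neg hv.ne]
  have h := h0 (wordsLT_mono hw (hψ w))
  rw [LinearMap.mem_ker, map_sub, sub_eq_zero, hπ] at h
  exact h

theorem ker_symbol (i : ℕ) {σ : Weyl k n →ₗ[k] SkewPolyRing k n}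
    (hσ : ∀ w : List (Fin n), w.length ≤ i →
      σ (w.map (wgen k n)).prod = if w.length = i then (w.map (sgen k n)).prod else 0)
    {u : Weyl k n} (hu : u ∈ weylV k n ^ i) : σ u = 0 ↔ u ∈ prevF k n i := by
  rw [prevF_eq_wordsLT]
  rw [weylV_pow_eq_wordsLT] at hu
  constructor
  · intro h
    obtain ⟨ψ, hψ⟩ :=
      (isAnticommPresentation_sgen k n).exists_linearMap (isAnticommPresentation_wgen k n)
    have key : wordsLT (wgen k n) (i + 1) ≤
        (wordsLT (wgen k n) i).comap (ψ ∘ₗ σ - LinearMap.id) := by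
      refine wordsLT_le fun w hw => ?_
      rw [Submodule.mem_comap, LinearMap.sub_apply, LinearMap.comp_apply, hσ w (by omega),
        LinearMap.id_apply]
      split_ifs with hi
      · exact hi ▸ hψ w
      · rw [map_zero, zero_sub]
        exact neg_mem (prod_mem_wordsLT (by omega))
    simpa [h] using key hu
  · intro h
    refine wordsLT_le (N := LinearMap.ker σ) (fun w hw => ?_) h
    rw [LinearMap.mem_ker, hσ w hw.le, if_neg hw.ne]

theorem map_symbol (i : ℕ) {σ : Weyl k n →ₗ[k] SkewPolyRing k n}
    (hσ : ∀ w : List (Fin n), w.length ≤ i →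
      σ (w.map (wgen k n)).prod = if w.length = i then (w.map (sgen k n)).prod else 0) :
    (weylV k n ^ i).map σ = skewDeg k n i := by
  rw [weylV_pow_eq_wordsLT]
  apply le_antisymm
  · rw [Submodule.map_le_iff_le_comap]
    refine wordsLT_le fun w hw => ?_
    rw [Submodule.mem_comap, hσ w (by omega)]
    split_ifs with h
    · exact Submodule.subset_span ⟨w, h, rfl⟩
    · exact zero_mem _
  · refine Submodule.span_le.2 ?_
    rintro _ ⟨w, h, rfl⟩
    refine ⟨(w.map (wgen k n)).prod, prod_mem_wordsLT (by omega), ?_⟩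
    rw [hσ w h.le, if_pos h]

theorem symbol_mul {σ : ℕ → Weyl k n →ₗ[k] SkewPolyRing k n}
    (hσ : ∀ i, ∀ w : List (Fin n), w.length ≤ i →
      σ i (w.map (wgen k n)).prod = if w.length = i then (w.map (sgen k n)).prod else 0)
    {i j : ℕ} {u v : Weyl k n} (hu : u ∈ weylV k n ^ i) (hv : v ∈ weylV k n ^ j) :
    σ (i + j) (u * v) = σ i u * σ j v := by
  rw [weylV_pow_eq_wordsLT] at hu hv
  refine wordsLT_le (N := LinearMap.eqLocus
    (σ (i + j) ∘ₗ LinearMap.mulRight k v) (LinearMap.mulRight k (σ j v) ∘ₗ σ i))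
    (fun a ha => ?_) hu
  refine wordsLT_le (N := LinearMap.eqLocus
    (σ (i + j) ∘ₗ LinearMap.mulLeft k (a.map (wgen k n)).prod)
    (LinearMap.mulLeft k (σ i (a.map (wgen k n)).prod) ∘ₗ σ j)) (fun b hb => ?_) hv
  have h := hσ (i + j) (a ++ b) (by rw [List.length_append]; omega)
  rw [List.map_append, List.prod_append, List.map_append, List.prod_append,
    List.length_append] at h
  rw [LinearMap.mem_eqLocus, LinearMap.comp_apply, LinearMap.comp_apply, LinearMap.mulLeft_apply,
    LinearMap.mulLeft_apply, h, hσ i a (by omega), hσ j b (by omega)]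
  by_cases h1 : a.length = i
  · simp [h1]
  · rw [if_neg h1, zero_mul, if_neg (by omega)]

/-- Let `R` be the quantum Weyl algebra (`xᵢxⱼ + xⱼxᵢ = 1` for `i ≠ j`,
`n ≥ 2`, `char k ∤ 2`), filtered by `F i = (k + Σ k xₛ)^i`.  Then the associated graded
algebra `gr R` is isomorphic, as a graded algebra, to `k₋₁[x₁,…,xₙ]` (relations
`xⱼxᵢ = -xᵢxⱼ`): there are degreewise linear isomorphisms compatible with multiplication,
units and generators. -/
theorem weyl_gr_iso_skewPoly (hn : 2 ≤ n) (h2 : (2 : k) ≠ 0) :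
    ∃ φ : ∀ i : ℕ, GrW k n i ≃ₗ[k] ↥(skewDeg k n i),
      (∀ (i j : ℕ) (u : ↥(weylV k n ^ i)) (v : ↥(weylV k n ^ j)),
        (φ (i + j) (grWMk k n (i + j) ⟨(u : Weyl k n) * v, mul_mem_weylV_pow k n u v⟩) :
            SkewPolyRing k n) =
          (φ i (grWMk k n i u) : SkewPolyRing k n) *
            (φ j (grWMk k n j v) : SkewPolyRing k n)) ∧
      (φ 0 (grWMk k n 0 ⟨1, one_mem_weylV_pow_zero k n⟩) : SkewPolyRing k n) = 1 ∧
      (∀ s : Fin n,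
        (φ 1 (grWMk k n 1 ⟨wgen k n s, wgen_mem_weylV_pow_one k n s⟩) : SkewPolyRing k n) =
          sgen k n s) := by
  choose σ hσ using exists_symbol k n
  let f (i : ℕ) : ↥(weylV k n ^ i) →ₗ[k] ↥(skewDeg k n i) :=
    (σ i).restrict fun u hu => map_symbol k n i (hσ i) ▸ Submodule.mem_map_of_mem hu
  have hker (i : ℕ) : (prevF k n i).comap (weylV k n ^ i).subtype = LinearMap.ker (f i) := by
    ext u
    rw [LinearMap.mem_ker, Submodule.mem_comap, ← Submodule.coe_eq_zero]
    exact (ker_symbol k n i (hσ i) u.2).symm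
  have hsurj (i : ℕ) : Function.Surjective (f i) := by
    rintro ⟨y, hy⟩
    rw [← map_symbol k n i (hσ i)] at hy
    obtain ⟨u, hu, rfl⟩ := hy
    exact ⟨⟨u, hu⟩, rfl⟩
  let φ (i : ℕ) : GrW k n i ≃ₗ[k] ↥(skewDeg k n i) :=
    (Submodule.quotEquivOfEq _ _ (hker i)).trans ((f i).quotKerEquivOfSurjective (hsurj i))
  have hφ (i : ℕ) (u : ↥(weylV k n ^ i)) : (φ i (grWMk k n i u) : SkewPolyRing k n) = σ i u := rfl
  refine ⟨φ, fun i j u v => ?_, ?_, fun s => ?_⟩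
  · rw [hφ, hφ, hφ]
    exact symbol_mul k n hσ u.2 v.2
  · rw [hφ]
    simpa using hσ 0 [] le_rfl
  · rw [hφ]
    simpa using hσ 1 [s] le_rfl

end
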